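/- For a partition λ of n, define the depth d_λ := n − λ₁, where λ₁ is the largest part of λ. The number of ordered triples (λ, μ, ν) of partitions of 12 satisfying |d_λ − d_μ| ≤ d_ν ≤ d_λ + d_μ is 406,919. -/

import Mathlib

/-- The depth of a partition `λ` of `n`: `d_λ = n - λ₁`, where `λ₁` is the
largest part of `λ`. -/
def partitionDepth (n : ℕ) (l : Nat.Partition n) : ℕ := n - l.parts.sup

open Finset in
/-- The number of partitions of `n` all of whose parts are at most `m`. -/
def boundedPartitionCount (n m : ℕ) : ℕ := #{p : n.Partition | p.parts.sup ≤ m}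

open Finset in
theorem boundedPartitionCount_zero_left (m : ℕ) : boundedPartitionCount 0 m = 1 := by
  simp [boundedPartitionCount]

open Finset in
theorem boundedPartitionCount_succ_zero (n : ℕ) : boundedPartitionCount (n + 1) 0 = 0 := by
  rw [boundedPartitionCount, card_eq_zero, filter_eq_empty_iff]
  intro p _ hp
  have hparts : p.parts = 0 := Multiset.eq_zero_of_forall_notMem fun a ha =>
    (p.parts_pos ha).ne' (Nat.le_zero.mp ((Multiset.le_sup ha).trans hp))
  simpa [hparts] using p.parts_sum

open Finset in
/-- Removing one copy of a part `a ≤ m` preserves the bound `m` on the parts. -/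
theorem card_filter_mem_parts_sup_le {n a m : ℕ} (ha : 1 ≤ a) (han : a ≤ n) (ham : a ≤ m) :
    #{p : n.Partition | a ∈ p.parts ∧ p.parts.sup ≤ m} = boundedPartitionCount (n - a) m := by
  rw [boundedPartitionCount, ← Fintype.card_subtype, ← Fintype.card_subtype]
  refine Fintype.card_congr ((Equiv.subtypeSubtypeEquivSubtypeInter _ _).symm.trans
    ((Nat.Partition.partitionWithPartEquiv ha han).subtypeEquiv fun p => ?_))
  conv_lhs => rw [← Multiset.cons_erase p.2]
  simp [Nat.Partition.partitionWithPartEquiv_apply_parts, ham]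

open Finset in
theorem boundedPartitionCount_succ_right (n m : ℕ) :
    boundedPartitionCount n (m + 1) = boundedPartitionCount n m +
      if m + 1 ≤ n then boundedPartitionCount (n - (m + 1)) (m + 1) else 0 := by
  have hnot (p : n.Partition) :
      (p.parts.sup ≤ m + 1 ∧ m + 1 ∉ p.parts) ↔ p.parts.sup ≤ m := by
    simp only [Multiset.sup_le]
    constructor
    · rintro ⟨h, hm⟩ b hb
      have := h b hb
      have : b ≠ m + 1 := fun e => hm (e ▸ hb)
      omega
    · intro h
      exact ⟨fun b hb => (h b hb).trans m.le_succ, fun hm => by simpa using h _ hm⟩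
  rw [boundedPartitionCount, ← card_filter_add_card_filter_not (fun p => m + 1 ∈ p.parts),
    filter_filter, filter_filter, add_comm]
  simp only [hnot]
  rw [← boundedPartitionCount]
  congr 1
  split_ifs with h
  · simp only [and_comm (b := _ ∈ _)]
    exact card_filter_mem_parts_sup_le m.succ_pos h le_rfl
  · rw [card_eq_zero, filter_eq_empty_iff]
    exact fun p _ hp => h (Nat.Partition.le_of_mem_parts hp.2)

theorem sup_parts_mem {n : ℕ} (hn : n ≠ 0) (p : n.Partition) : p.parts.sup ∈ p.parts := by
  have hne : p.parts ≠ 0 := fun h => hn (by simpa [h] using p.parts_sum.symm)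
  have hsup (s : Multiset ℕ) (hs : s ≠ 0) : s.sup ∈ s := by
    induction s using Multiset.induction with
    | empty => exact absurd rfl hs
    | cons a s ih =>
      rw [Multiset.sup_cons]
      rcases eq_or_ne s 0 with rfl | h
      · simp
      · rcases le_total a s.sup with h' | h'
        · rw [sup_eq_right.mpr h']
          exact Multiset.mem_cons_of_mem (ih h)
        · simp [sup_eq_left.mpr h']
  exact hsup _ hne

open Finset in
/-- Removing the largest part identifies the partitions of `n` of depth `d` with the partitions
of `d` whose parts are at most `n - d`. -/
theorem card_filter_partitionDepth_eq {n d : ℕ} (hd : d < n) :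
    #{p : n.Partition | partitionDepth n p = d} = boundedPartitionCount d (n - d) := by
  have key := card_filter_mem_parts_sup_le (n := n) (a := n - d) (m := n - d) (by omega)
    (by omega) le_rfl
  rw [Nat.sub_sub_self hd.le] at key
  rw [← key]
  congr 1
  ext p
  have hmem := sup_parts_mem (by omega) p
  have hle := Nat.Partition.le_of_mem_parts hmem
  rw [mem_filter_univ, mem_filter_univ, partitionDepth]
  constructor
  · intro h
    have heq : n - d = p.parts.sup := by omega
    exact ⟨heq ▸ hmem, heq.ge⟩
  · rintro ⟨h, h'⟩
    have := Multiset.le_sup h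
    omega

open Finset in
theorem sum_comp_partitionDepth {n : ℕ} (hn : n ≠ 0) (f : ℕ → ℕ) :
    ∑ p : n.Partition, f (partitionDepth n p) =
      ∑ d ∈ range n, boundedPartitionCount d (n - d) * f d := by
  have hmaps : ∀ p ∈ (univ : Finset n.Partition), partitionDepth n p ∈ range n := fun p _ => by
    have := p.parts_pos (sup_parts_mem hn p)
    simp only [mem_range, partitionDepth]
    omega
  rw [← sum_fiberwise_of_maps_to hmaps]
  refine sum_congr rfl fun d hd => ?_
  rw [sum_congr rfl fun p hp => by rw [(mem_filter.mp hp).2], sum_const,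
    card_filter_partitionDepth_eq (mem_range.mp hd), smul_eq_mul]

theorem boundedPartitionCount_twelve_sub (d : ℕ) (hd : d ∈ Finset.range 12) :
    boundedPartitionCount d (12 - d) = [1, 1, 2, 3, 5, 7, 11, 13, 15, 12, 6, 1].getD d 0 := by
  rw [Finset.mem_range] at hd
  interval_cases d <;>
    simp [boundedPartitionCount_zero_left, boundedPartitionCount_succ_zero,
      boundedPartitionCount_succ_right]

/-- The number of ordered triples `(λ, μ, ν)` of partitions of 12 satisfying
`|d_λ − d_μ| ≤ d_ν ≤ d_λ + d_μ` is 406,919. -/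
theorem card_depth_triples_twelve :
    Fintype.card
      {t : Nat.Partition 12 × Nat.Partition 12 × Nat.Partition 12 //
        |(partitionDepth 12 t.1 : ℤ) - (partitionDepth 12 t.2.1 : ℤ)| ≤
            (partitionDepth 12 t.2.2 : ℤ) ∧
          (partitionDepth 12 t.2.2 : ℤ) ≤
            (partitionDepth 12 t.1 : ℤ) + (partitionDepth 12 t.2.1 : ℤ)} = 406919 := by
  rw [Fintype.card_subtype, Finset.card_filter, Fintype.sum_prod_type]
  simp only [Fintype.sum_prod_type]
  let c (a b d : ℕ) : ℕ := if a ≤ b + d ∧ b ≤ a + d ∧ d ≤ a + b then 1 else 0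
  let N (d : ℕ) : ℕ := [1, 1, 2, 3, 5, 7, 11, 13, 15, 12, 6, 1].getD d 0
  have hsum (f : ℕ → ℕ) : ∑ p : Nat.Partition 12, f (partitionDepth 12 p) =
      ∑ d ∈ Finset.range 12, N d * f d := by
    rw [sum_comp_partitionDepth (n := 12) (by norm_num)]
    exact Finset.sum_congr rfl fun d hd => by rw [boundedPartitionCount_twelve_sub d hd]
  calc
    _ = ∑ p, ∑ q, ∑ r, c (partitionDepth 12 p) (partitionDepth 12 q) (partitionDepth 12 r) := by
      refine Fintype.sum_congr _ _ fun p => Fintype.sum_congr _ _ fun q =>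
        Fintype.sum_congr _ _ fun r => if_congr ?_ rfl rfl
      rw [abs_le]
      omega
    _ = ∑ a ∈ Finset.range 12, N a * ∑ b ∈ Finset.range 12, N b *
          ∑ d ∈ Finset.range 12, N d * c a b d := by
      simp only [fun a b => hsum (c a b)]
      simp only [fun a => hsum fun b => ∑ d ∈ Finset.range 12, N d * c a b d]
      exact hsum fun a => ∑ b ∈ Finset.range 12, N b * ∑ d ∈ Finset.range 12, N d * c a b d
    _ = 406919 := by decide +kernel
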